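/- Let φ : Γ → K be a group homomorphism with image K' := im(φ), and let J := K/K' be the set of left cosets with the left-translation K-action, V := ℓ∞(J, ℝ). If the restriction-of-scalars map V^K → (φ⁻¹V)^Γ (which is the inclusion of K-fixed points into Γ-fixed points, where Γ acts via φ) is surjective, then φ is surjective. -/

import Mathlib

open scoped ENNReal

noncomputable section

/-- Let `φ : Γ → K` be a group homomorphism, `J = K/im(φ)` the set of
left cosets with the translation `K`-action, and `V = ℓ∞(J, ℝ)`.  If every `Γ`-invariant
element of `V` (for the action via `φ`) is already `K`-invariant — i.e. the inclusion
`V^K → (φ⁻¹V)^Γ` is surjective — then `φ` is surjective. -/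
theorem surjective_of_fixedPoints_restriction_surjective
    {Γ K : Type*} [Group Γ] [Group K] (φ : Γ →* K)
    (hsurj : ∀ F : lp (fun _ : K ⧸ φ.range => ℝ) ∞,
      (∀ (g : Γ) (j : K ⧸ φ.range), F ((φ g)⁻¹ • j) = F j) →
      (∀ (k : K) (j : K ⧸ φ.range), F (k⁻¹ • j) = F j)) :
    Function.Surjective φ := by
  classical
  intro k
  have hfix (g : Γ) (j : K ⧸ φ.range) :
      (φ g)⁻¹ • j = ((1 : K) : K ⧸ φ.range) ↔ j = ((1 : K) : K ⧸ φ.range) := by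
    have h : φ g • ((1 : K) : K ⧸ φ.range) = ((1 : K) : K ⧸ φ.range) := by
      rw [MulAction.Quotient.smul_coe, smul_eq_mul, mul_one, eq_comm, QuotientGroup.eq]
      simp
    rw [inv_smul_eq_iff, h]
  have hk := hsurj (lp.single ∞ ((1 : K) : K ⧸ φ.range) (1 : ℝ))
    (fun g j => by simp only [lp.single_apply, Pi.single_apply, hfix])
    k (k : K ⧸ φ.range)
  rw [MulAction.Quotient.smul_coe, smul_eq_mul, inv_mul_cancel] at hk
  simp only [lp.single_apply, Pi.single_apply, if_true] at hk
  have hcoset : (k : K ⧸ φ.range) = ((1 : K) : K ⧸ φ.range) := by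
    by_contra hne
    simp [hne] at hk
  have hmem := QuotientGroup.eq.1 hcoset.symm
  simpa using hmem
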